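/- Let n ≥ 1, l ≥ 1 be integers and R, T > 0. Let a_{2l+1} = diag(a_{(2l+1)i}) and a_{2l} = diag(a_{(2l)i}) be constant diagonal n×n real matrices with a_{(2l+1)i} > 0 and a_{(2l)i} ≤ 0 for all i = 1,…,n, and for j = 0,…,2l−1 let a_j : [0,T] × [0,R] → ℝ^{n×n} be smooth matrix-valued functions. Then there exists a constant c > 0, depending only on T, R, l, n and the coefficient matrices a_0,…,a_{2l+1}, such that: for all smooth functions f, G₀, …, G_l : [0,T] × [0,R] → ℝⁿ and every smooth u : [0,T] × [0,R] → ℝⁿ satisfying ∂_t u − (−1)^l ( a_{2l+1} ∂_x^{2l+1} u + a_{2l} ∂_x^{2l} u ) − Σ_{j=0}^{l−1} (−1)^j ∂_x^j [ a_{2j+1}(t,x) ∂_x^{j+1} u + a_{2j}(t,x) ∂_x^{j} u ] = f + Σ_{j=0}^{l} (−1)^j ∂_x^j G_j on [0,T] × [0,R], with u(0,x) = 0 for all x ∈ [0,R], ∂_x^j u(t,0) = 0 for j = 0,…,l−1 and ∂_x^j u(t,R) = 0 for j = 0,…,l for all t ∈ [0,T], one has ‖u‖_{Xⁿ(Q_T)}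 ≤ c ( ∫₀^T (∫₀^R |f(t,x)|² dx)^{1/2} dt + Σ_{j=0}^{l} ‖ |G_j| ‖_{L^{2l/(2l−j)}(0,T;L²(I))} ). -/

import Mathlib

open MeasureTheory Set

/-- The norm of the space `X(Q_T)` for scalar functions. -/
noncomputable def XNorm (l : ℕ) (R T : ℝ) (v : ℝ → ℝ → ℝ) : ℝ :=
  (⨆ t ∈ Set.Icc (0:ℝ) T, Real.sqrt (∫ x in (0:ℝ)..R, (v t x) ^ 2)) +
  Real.sqrt (∫ t in (0:ℝ)..T, ∫ x in (0:ℝ)..R, (iteratedDeriv l (v t) x) ^ 2)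

/-- The mixed norm `L^q(0,T;L²(0,R))`. -/
noncomputable def mixedNorm (q R T : ℝ) (F : ℝ → ℝ → ℝ) : ℝ :=
  (∫ t in (0:ℝ)..T, (∫ x in (0:ℝ)..R, (F t x) ^ 2) ^ (q / 2)) ^ (1 / q)


theorem ContDiff.contDiff_top_iteratedDeriv {v : ℝ → ℝ} (hv : ContDiff ℝ (⊤ : ℕ∞) v) (k : ℕ) :
    ContDiff ℝ (⊤ : ℕ∞) (iteratedDeriv k v) := by
  rw [iteratedDeriv_eq_iterate]
  exact hv.iterate_deriv k

theorem ContDiff.hasDerivAt_iteratedDeriv {v : ℝ → ℝ} (hv : ContDiff ℝ (⊤ : ℕ∞) v) (k : ℕ)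
    (x : ℝ) : HasDerivAt (iteratedDeriv k v) (iteratedDeriv (k + 1) v x) x := by
  rw [iteratedDeriv_succ]
  exact ((hv.contDiff_top_iteratedDeriv k).differentiable (by simp) x).hasDerivAt

theorem ContDiff.continuous_iteratedDeriv_top {v : ℝ → ℝ} (hv : ContDiff ℝ (⊤ : ℕ∞) v) (k : ℕ) :
    Continuous (iteratedDeriv k v) :=
  (hv.contDiff_top_iteratedDeriv k).continuous

theorem iteratedDeriv_comp_iteratedDeriv (v : ℝ → ℝ) (j k : ℕ) :
    iteratedDeriv j (iteratedDeriv k v) = iteratedDeriv (j + k) v := by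
  simp only [iteratedDeriv_eq_iterate, Function.iterate_add_apply]

/-- Iterated integration by parts on `[0, R]` when the second factor vanishes to order `j` at both
end points. -/
theorem integral_iteratedDeriv_mul {R : ℝ} (j : ℕ) {g w : ℝ → ℝ}
    (hg : ContDiff ℝ (⊤ : ℕ∞) g) (hw : ContDiff ℝ (⊤ : ℕ∞) w)
    (h0 : ∀ k < j, iteratedDeriv k w 0 = 0) (hR : ∀ k < j, iteratedDeriv k w R = 0) :
    ∫ x in (0:ℝ)..R, iteratedDeriv j g x * w x =
      (-1) ^ j * ∫ x in (0:ℝ)..R, g x * iteratedDeriv j w x := by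
  induction j generalizing g with
  | zero => simp
  | succ j ih =>
    rw [iteratedDeriv_succ', ih (by simpa using hg.contDiff_top_iteratedDeriv 1)
      (fun k hk => h0 k (by omega)) (fun k hk => hR k (by omega))]
    have hgd : ∀ x, HasDerivAt g (deriv g x) x := fun x => by
      simpa using hg.hasDerivAt_iteratedDeriv 0 x
    have := intervalIntegral.integral_mul_deriv_eq_deriv_mul (a := 0) (b := R)
      (u := iteratedDeriv j w) (v := g) (u' := iteratedDeriv (j + 1) w) (v' := deriv g)
      (fun x _ => hw.hasDerivAt_iteratedDeriv j x) (fun x _ => hgd x)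
      ((hw.continuous_iteratedDeriv_top _).intervalIntegrable _ _)
      ((by simpa using hg.continuous_iteratedDeriv_top 1 : Continuous (deriv g)).intervalIntegrable
        _ _)
    rw [h0 j (by omega), hR j (by omega)] at this
    simp only [zero_mul, sub_zero, zero_sub] at this
    simp only [mul_comm (deriv g _), mul_comm (g _)]
    rw [this]
    ring

theorem iteratedDeriv_one_add_mul {v : ℝ → ℝ} (hv : ContDiff ℝ (⊤ : ℕ∞) v) (j : ℕ) (x : ℝ) :
    iteratedDeriv j (fun y => (1 + y) * v y) x =
      (1 + x) * iteratedDeriv j v x + j * iteratedDeriv (j - 1) v x := by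
  induction j generalizing x with
  | zero => simp
  | succ j ih =>
    rw [iteratedDeriv_succ, show iteratedDeriv j (fun y => (1 + y) * v y) = _ from funext ih]
    have h1 : HasDerivAt (fun x : ℝ => 1 + x) 1 x := (hasDerivAt_id x).const_add 1
    have h2 := (h1.mul (hv.hasDerivAt_iteratedDeriv j x)).add
      ((hv.hasDerivAt_iteratedDeriv (j - 1) x).const_mul (j : ℝ))
    refine h2.deriv.trans ?_
    rcases j with _ | j
    · simp; ring
    · simp; ring

/-- Smooth functions on the line satisfying the boundary conditions `v^{(k)}(0) = 0`, `k < l`, and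
`v^{(k)}(R) = 0`, `k ≤ l`. -/
structure SatisfiesBoundary (l : ℕ) (R : ℝ) (v : ℝ → ℝ) : Prop where
  smooth : ContDiff ℝ (⊤ : ℕ∞) v
  left : ∀ k < l, iteratedDeriv k v 0 = 0
  right : ∀ k ≤ l, iteratedDeriv k v R = 0

/-- The squared `L²(0,R)` norm of the `k`-th derivative. -/
noncomputable def derivEnergy (R : ℝ) (k : ℕ) (v : ℝ → ℝ) : ℝ :=
  ∫ x in (0:ℝ)..R, (iteratedDeriv k v x) ^ 2

theorem derivEnergy_nonneg {R : ℝ} (hR : 0 < R) (k : ℕ) (v : ℝ → ℝ) : 0 ≤ derivEnergy R k v :=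
  intervalIntegral.integral_nonneg hR.le fun _ _ => sq_nonneg _

theorem sq_integral_mul_le {R : ℝ} (hR : 0 < R) {g w : ℝ → ℝ} (hg : Continuous g)
    (hw : Continuous w) :
    (∫ x in (0:ℝ)..R, g x * w x) ^ 2 ≤ (∫ x in (0:ℝ)..R, g x ^ 2) * ∫ x in (0:ℝ)..R, w x ^ 2 := by
  have key : ∀ s : ℝ, 0 ≤ (∫ x in (0:ℝ)..R, g x ^ 2) * (s * s) +
      (2 * ∫ x in (0:ℝ)..R, g x * w x) * s + ∫ x in (0:ℝ)..R, w x ^ 2 := fun s => by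
    have h : 0 ≤ ∫ x in (0:ℝ)..R, (s * g x + w x) ^ 2 :=
      intervalIntegral.integral_nonneg hR.le fun _ _ => sq_nonneg _
    have e : ∀ x, (s * g x + w x) ^ 2 = s ^ 2 * g x ^ 2 + (2 * s) * (g x * w x) + w x ^ 2 :=
      fun x => by ring
    simp only [e] at h
    rw [intervalIntegral.integral_add, intervalIntegral.integral_add,
      intervalIntegral.integral_const_mul, intervalIntegral.integral_const_mul] at h
    · linarith
    all_goals exact Continuous.intervalIntegrable (by fun_prop) _ _
  have := discrim_le_zero key
  unfold discrim at this
  linarith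

theorem integral_mul_le_sqrt {R : ℝ} (hR : 0 < R) {g w : ℝ → ℝ} (hg : Continuous g)
    (hw : Continuous w) :
    ∫ x in (0:ℝ)..R, g x * w x ≤
      √(∫ x in (0:ℝ)..R, g x ^ 2) * √(∫ x in (0:ℝ)..R, w x ^ 2) := by
  rw [← Real.sqrt_mul (intervalIntegral.integral_nonneg hR.le fun _ _ => sq_nonneg _)]
  exact Real.le_sqrt_of_sq_le (sq_integral_mul_le hR hg hw)

namespace SatisfiesBoundary

variable {l : ℕ} {R : ℝ} {v : ℝ → ℝ}

theorem continuous_iteratedDeriv (h : SatisfiesBoundary l R v) (k : ℕ) :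
    Continuous (iteratedDeriv k v) :=
  h.smooth.continuous_iteratedDeriv_top k

theorem smooth_weighted (h : SatisfiesBoundary l R v) :
    ContDiff ℝ (⊤ : ℕ∞) fun x => (1 + x) * v x :=
  (contDiff_const.add contDiff_id).mul h.smooth

theorem weighted_left (h : SatisfiesBoundary l R v) {k : ℕ} (hk : k < l) :
    iteratedDeriv k (fun x => (1 + x) * v x) 0 = 0 := by
  rw [iteratedDeriv_one_add_mul h.smooth, h.left k hk, h.left (k - 1) (by omega)]
  simp

theorem weighted_right (h : SatisfiesBoundary l R v) {k : ℕ} (hk : k ≤ l) :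
    iteratedDeriv k (fun x => (1 + x) * v x) R = 0 := by
  rw [iteratedDeriv_one_add_mul h.smooth, h.right k hk, h.right (k - 1) (by omega)]
  simp

/-- Integration by parts against the weighted solution. -/
theorem integral_iteratedDeriv_mul_weighted (h : SatisfiesBoundary l R v) {g : ℝ → ℝ}
    (hg : ContDiff ℝ (⊤ : ℕ∞) g) {j : ℕ} (hj : j ≤ l) :
    ∫ x in (0:ℝ)..R, ((-1) ^ j * iteratedDeriv j g x) * ((1 + x) * v x) =
      ∫ x in (0:ℝ)..R, g x * ((1 + x) * iteratedDeriv j v x + j * iteratedDeriv (j - 1) v x) := by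
  have := integral_iteratedDeriv_mul (R := R) j hg h.smooth_weighted
    (fun k hk => h.weighted_left (by omega)) (fun k hk => h.weighted_right (by omega))
  simp only [iteratedDeriv_one_add_mul h.smooth] at this
  simp only [mul_assoc, intervalIntegral.integral_const_mul] at this ⊢
  rw [this, ← mul_assoc, ← mul_pow]
  simp

/-- The leading odd-order operator is dissipative in the weighted space. -/
theorem integral_leading_le (h : SatisfiesBoundary l R v) (hl : 1 ≤ l) (hR : 0 < R) :
    ∫ x in (0:ℝ)..R, ((-1) ^ l * iteratedDeriv (2 * l + 1) v x) * ((1 + x) * v x) ≤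
      -(1 / 2) * derivEnergy R l v := by
  have e := h.integral_iteratedDeriv_mul_weighted (h.smooth.contDiff_top_iteratedDeriv (l + 1))
    le_rfl
  rw [iteratedDeriv_comp_iteratedDeriv, show l + (l + 1) = 2 * l + 1 by ring] at e
  rw [e]
  have hd : ∀ x, HasDerivAt (fun x => (1 + x) * (iteratedDeriv l v x) ^ 2 / 2 +
      l * (iteratedDeriv l v x * iteratedDeriv (l - 1) v x))
      (iteratedDeriv (l + 1) v x * ((1 + x) * iteratedDeriv l v x +
        l * iteratedDeriv (l - 1) v x) + (l + 1 / 2) * (iteratedDeriv l v x) ^ 2) x := fun x => by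
    have h1 : HasDerivAt (fun x : ℝ => 1 + x) 1 x := (hasDerivAt_id x).const_add 1
    have h2 := h.smooth.hasDerivAt_iteratedDeriv l x
    have h3 := h.smooth.hasDerivAt_iteratedDeriv (l - 1) x
    rw [Nat.sub_add_cancel hl] at h3
    refine HasDerivAt.congr_deriv (((h1.mul (h2.pow 2)).div_const 2).add ((h2.mul h3).const_mul (l : ℝ))) ?_
    simp
    ring
  have c0 := h.continuous_iteratedDeriv l
  have c1 := h.continuous_iteratedDeriv (l - 1)
  have c2 := h.continuous_iteratedDeriv (l + 1)
  have ftc := intervalIntegral.integral_eq_sub_of_hasDerivAt (a := 0) (b := R) (fun x _ => hd x)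
    (Continuous.intervalIntegrable (by fun_prop) _ _)
  rw [intervalIntegral.integral_add (Continuous.intervalIntegrable (by fun_prop) _ _)
    (Continuous.intervalIntegrable (by fun_prop) _ _), intervalIntegral.integral_const_mul,
    h.right l le_rfl, h.left (l - 1) (by omega)] at ftc
  change _ + (l + 1 / 2) * derivEnergy R l v = _ at ftc
  have := mul_nonneg (Nat.cast_nonneg (α := ℝ) l) (derivEnergy_nonneg hR l v)
  nlinarith [sq_nonneg (iteratedDeriv l v 0)]

/-- The even-order operator has the favourable sign in the weighted space. -/
theorem integral_even_nonneg (h : SatisfiesBoundary l R v) (hl : 1 ≤ l) (hR : 0 < R) :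
    0 ≤ ∫ x in (0:ℝ)..R, ((-1) ^ l * iteratedDeriv (2 * l) v x) * ((1 + x) * v x) := by
  have e := h.integral_iteratedDeriv_mul_weighted (h.smooth.contDiff_top_iteratedDeriv l)
    le_rfl
  rw [iteratedDeriv_comp_iteratedDeriv, ← two_mul] at e
  rw [e]
  have hd : ∀ x, HasDerivAt (fun x => l * (iteratedDeriv (l - 1) v x) ^ 2 / 2)
      (l * (iteratedDeriv l v x * iteratedDeriv (l - 1) v x)) x := fun x => by
    have h3 := h.smooth.hasDerivAt_iteratedDeriv (l - 1) x
    rw [Nat.sub_add_cancel hl] at h3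
    refine HasDerivAt.congr_deriv (((h3.pow 2).const_mul (l : ℝ)).div_const 2) ?_
    simp
    ring
  have c0 := h.continuous_iteratedDeriv l
  have c1 := h.continuous_iteratedDeriv (l - 1)
  have ftc := intervalIntegral.integral_eq_sub_of_hasDerivAt (a := 0) (b := R) (fun x _ => hd x)
    (Continuous.intervalIntegrable (by fun_prop) _ _)
  rw [h.right (l - 1) (by omega), h.left (l - 1) (by omega), sub_self] at ftc
  have e2 : ∀ x, iteratedDeriv l v x * ((1 + x) * iteratedDeriv l v x +
      l * iteratedDeriv (l - 1) v x) = (1 + x) * (iteratedDeriv l v x) ^ 2 +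
        l * (iteratedDeriv l v x * iteratedDeriv (l - 1) v x) := fun x => by ring
  simp only [e2]
  rw [intervalIntegral.integral_add (Continuous.intervalIntegrable (by fun_prop) _ _)
    (Continuous.intervalIntegrable (by fun_prop) _ _), ftc, add_zero]
  refine intervalIntegral.integral_nonneg hR.le fun x hx => ?_
  have := hx.1
  positivity

theorem sq_derivEnergy_le (h : SatisfiesBoundary l R v) (hR : 0 < R) {k : ℕ} (hk : k + 1 ≤ l) :
    derivEnergy R (k + 1) v ^ 2 ≤ derivEnergy R k v * derivEnergy R (k + 2) v := by
  have c0 := h.continuous_iteratedDeriv k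
  have c1 := h.continuous_iteratedDeriv (k + 1)
  have c2 := h.continuous_iteratedDeriv (k + 2)
  have ibp := intervalIntegral.integral_mul_deriv_eq_deriv_mul (a := 0) (b := R)
    (fun x _ => h.smooth.hasDerivAt_iteratedDeriv (k + 1) x)
    (fun x _ => h.smooth.hasDerivAt_iteratedDeriv k x)
    (c2.intervalIntegrable _ _) (c1.intervalIntegrable _ _)
  rw [h.left k (by omega), h.right k (by omega)] at ibp
  have : derivEnergy R (k + 1) v =
      -∫ x in (0:ℝ)..R, iteratedDeriv k v x * iteratedDeriv (k + 2) v x := by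
    simp only [derivEnergy, sq, ibp]
    simp [mul_comm]
  rw [this, neg_sq]
  exact sq_integral_mul_le hR c0 c2

/-- Poincaré inequality. -/
theorem derivEnergy_le_succ (h : SatisfiesBoundary l R v) (hR : 0 < R) {k : ℕ} (hk : k ≤ l) :
    derivEnergy R k v ≤ 4 * R ^ 2 * derivEnergy R (k + 1) v := by
  have c0 := h.continuous_iteratedDeriv k
  have c1 := h.continuous_iteratedDeriv (k + 1)
  have hd : ∀ x, HasDerivAt (fun x => x * (iteratedDeriv k v x) ^ 2)
      (iteratedDeriv k v x ^ 2 + 2 * x * iteratedDeriv k v x * iteratedDeriv (k + 1) v x) x :=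
    fun x => by
      refine HasDerivAt.congr_deriv ((hasDerivAt_id x).mul ((h.smooth.hasDerivAt_iteratedDeriv k x).pow 2)) ?_
      simp
      ring
  have ftc := intervalIntegral.integral_eq_sub_of_hasDerivAt (a := 0) (b := R) (fun x _ => hd x)
    (Continuous.intervalIntegrable (by fun_prop) _ _)
  rw [h.right k hk] at ftc
  have mono : ∫ x in (0:ℝ)..R, (1 / 2 * iteratedDeriv k v x ^ 2 -
      2 * R ^ 2 * iteratedDeriv (k + 1) v x ^ 2) ≤ ∫ x in (0:ℝ)..R,
      (iteratedDeriv k v x ^ 2 + 2 * x * iteratedDeriv k v x * iteratedDeriv (k + 1) v x) := by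
    refine intervalIntegral.integral_mono_on hR.le
      (Continuous.intervalIntegrable (by fun_prop) _ _)
      (Continuous.intervalIntegrable (by fun_prop) _ _) fun x hx => ?_
    have hx2 : x ^ 2 ≤ R ^ 2 := pow_le_pow_left₀ hx.1 hx.2 2
    have := mul_le_mul_of_nonneg_right hx2 (sq_nonneg (iteratedDeriv (k + 1) v x))
    nlinarith [sq_nonneg (iteratedDeriv k v x + 2 * x * iteratedDeriv (k + 1) v x)]
  rw [ftc, intervalIntegral.integral_sub (Continuous.intervalIntegrable (by fun_prop) _ _)
    (Continuous.intervalIntegrable (by fun_prop) _ _), intervalIntegral.integral_const_mul,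
    intervalIntegral.integral_const_mul] at mono
  change 1 / 2 * derivEnergy R k v - 2 * R ^ 2 * derivEnergy R (k + 1) v ≤ _ at mono
  linarith

end SatisfiesBoundary

/-- A log-convex finite sequence lies below its geometric chord. -/
theorem pow_le_of_log_convex {e : ℕ → ℝ} (he : ∀ k, 0 ≤ e k) {l : ℕ}
    (hc : ∀ k, k + 1 < l → e (k + 1) ^ 2 ≤ e k * e (k + 2)) {j : ℕ} (hj : j ≤ l) :
    e j ^ l ≤ e l ^ j * e 0 ^ (l - j) := by
  have step : ∀ j, j < l → e j ^ (j + 1) ≤ e (j + 1) ^ j * e 0 := by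
    intro j
    induction j with
    | zero => simp
    | succ j ih =>
      intro hj
      rcases (he (j + 1)).eq_or_lt with h0 | hpos
      · rw [← h0]
        have := he (j + 1 + 1)
        have := he 0
        simp only [ne_eq, Nat.add_eq_zero_iff, one_ne_zero, and_false, not_false_eq_true, zero_pow]
        positivity
      · have h1 := ih (by omega)
        have h2 := pow_le_pow_left₀ (sq_nonneg _) (hc j hj) (j + 1)
        have h3 : e (j + 1) ^ j * e (j + 1) ^ (j + 1 + 1) ≤
            e (j + 1) ^ j * (e (j + 1 + 1) ^ (j + 1) * e 0) := by
          calc e (j + 1) ^ j * e (j + 1) ^ (j + 1 + 1) = (e (j + 1) ^ 2) ^ (j + 1) := by ring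
            _ ≤ (e j * e (j + 2)) ^ (j + 1) := h2
            _ = e j ^ (j + 1) * e (j + 2) ^ (j + 1) := by ring
            _ ≤ (e (j + 1) ^ j * e 0) * e (j + 2) ^ (j + 1) :=
              mul_le_mul_of_nonneg_right h1 (pow_nonneg (he _) _)
            _ = _ := by ring
        exact le_of_mul_le_mul_left h3 (by positivity)
  have main : ∀ m, j ≤ m → m ≤ l → e j ^ m ≤ e m ^ j * e 0 ^ (m - j) := by
    intro m hm
    induction m, hm using Nat.le_induction with
    | base => simp
    | succ m hm ih =>
      intro hml
      have h1 := ih (by omega)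
      have h2 := step m (by omega)
      rcases Nat.eq_zero_or_pos m with rfl | hm0
      · obtain rfl : j = 0 := by omega
        simp
      refine le_of_pow_le_pow_left₀ hm0.ne'
        (mul_nonneg (pow_nonneg (he _) _) (pow_nonneg (he _) _)) ?_
      obtain ⟨d, rfl⟩ := Nat.exists_eq_add_of_le hm
      have e1 : j + d - j = d := by omega
      have e2 : j + d + 1 - j = d + 1 := by omega
      rw [e1] at h1
      rw [e2]
      calc (e j ^ (j + d + 1)) ^ (j + d) = (e j ^ (j + d)) ^ (j + d + 1) := by ring
        _ ≤ (e (j + d) ^ j * e 0 ^ d) ^ (j + d + 1) :=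
          pow_le_pow_left₀ (pow_nonneg (he _) _) h1 _
        _ = (e (j + d) ^ (j + d + 1)) ^ j * e 0 ^ (d * (j + d + 1)) := by ring
        _ ≤ (e (j + d + 1) ^ (j + d) * e 0) ^ j * e 0 ^ (d * (j + d + 1)) :=
          mul_le_mul_of_nonneg_right (pow_le_pow_left₀ (pow_nonneg (he _) _) h2 _)
            (pow_nonneg (he _) _)
        _ = _ := by ring
  exact main l hj le_rfl

namespace SatisfiesBoundary

variable {l : ℕ} {R : ℝ} {v : ℝ → ℝ}

/-- Gagliardo–Nirenberg interpolation. -/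
theorem derivEnergy_pow_le (h : SatisfiesBoundary l R v) (hR : 0 < R) {j : ℕ} (hj : j ≤ l) :
    derivEnergy R j v ^ l ≤ derivEnergy R l v ^ j * derivEnergy R 0 v ^ (l - j) :=
  pow_le_of_log_convex (e := fun k => derivEnergy R k v) (fun k => derivEnergy_nonneg hR k v)
    (fun _ hk => h.sq_derivEnergy_le hR hk.le) hj

end SatisfiesBoundary

/-- Interpolation with a small constant in front of the highest derivative. -/
theorem exists_derivEnergy_le (l : ℕ) {R : ℝ} (hR : 0 < R) {ε : ℝ} (hε : 0 < ε) :
    ∃ C : ℝ, 0 ≤ C ∧ ∀ v, SatisfiesBoundary l R v → ∀ k < l,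
      derivEnergy R k v ≤ ε * derivEnergy R l v + C * derivEnergy R 0 v := by
  refine ⟨(1 + ε⁻¹) ^ l, by positivity, fun v hv k hk => ?_⟩
  have hk0 := derivEnergy_nonneg hR k v
  have hl0 := derivEnergy_nonneg hR l v
  have h00 := derivEnergy_nonneg hR 0 v
  by_cases hc : derivEnergy R k v ≤ ε * derivEnergy R l v
  · have : 0 ≤ (1 + ε⁻¹) ^ l * derivEnergy R 0 v := by positivity
    linarith
  push Not at hc
  have hkpos : 0 < derivEnergy R k v := lt_of_le_of_lt (by positivity) hc
  have h1 : derivEnergy R l v ≤ (1 + ε⁻¹) * derivEnergy R k v := by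
    have : derivEnergy R l v ≤ ε⁻¹ * derivEnergy R k v := by
      rw [inv_mul_eq_div, le_div_iff₀ hε]; linarith
    linarith
  have h2 := hv.derivEnergy_pow_le hR hk.le
  obtain ⟨d, rfl⟩ := Nat.exists_eq_add_of_lt hk
  rw [show k + d + 1 - k = d + 1 by omega] at h2
  set E := derivEnergy R k v
  have hb : (1:ℝ) ≤ 1 + ε⁻¹ := by have := inv_pos.2 hε; linarith
  have h3 : E ^ k * E ^ (d + 1) ≤ E ^ k * ((1 + ε⁻¹) ^ k * derivEnergy R 0 v ^ (d + 1)) := by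
    calc E ^ k * E ^ (d + 1) = E ^ (k + d + 1) := by ring
      _ ≤ _ := h2
      _ ≤ ((1 + ε⁻¹) * E) ^ k * derivEnergy R 0 v ^ (d + 1) := by gcongr
      _ = _ := by rw [mul_pow]; ring
  have h4 := le_of_mul_le_mul_left h3 (by positivity)
  have h5 : E ^ (d + 1) ≤ ((1 + ε⁻¹) ^ (k + d + 1) * derivEnergy R 0 v) ^ (d + 1) := by
    refine h4.trans ?_
    rw [mul_pow, ← pow_mul]
    gcongr
    nlinarith
  have h6 := le_of_pow_le_pow_left₀ (by omega) (by positivity) h5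
  have : 0 ≤ ε * derivEnergy R (k + d + 1) v := by positivity
  linarith

theorem SatisfiesBoundary.integral_sq_weighted_le {l : ℕ} {R : ℝ} {v : ℝ → ℝ}
    (h : SatisfiesBoundary l R v) (hR : 0 < R) {j : ℕ} (hj : j ≤ l) :
    ∫ x in (0:ℝ)..R, ((1 + x) * iteratedDeriv j v x + j * iteratedDeriv (j - 1) v x) ^ 2 ≤
      2 * (1 + R) ^ 2 * derivEnergy R j v + 2 * l ^ 2 * derivEnergy R (j - 1) v := by
  have c0 := h.continuous_iteratedDeriv j
  have c1 := h.continuous_iteratedDeriv (j - 1)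
  have hjl : (j:ℝ) ^ 2 ≤ (l:ℝ) ^ 2 := by gcongr
  have mono : ∫ x in (0:ℝ)..R,
      ((1 + x) * iteratedDeriv j v x + j * iteratedDeriv (j - 1) v x) ^ 2 ≤
      ∫ x in (0:ℝ)..R, (2 * (1 + R) ^ 2 * iteratedDeriv j v x ^ 2 +
        2 * l ^ 2 * iteratedDeriv (j - 1) v x ^ 2) := by
    refine intervalIntegral.integral_mono_on hR.le
      (Continuous.intervalIntegrable (by fun_prop) _ _)
      (Continuous.intervalIntegrable (by fun_prop) _ _) fun x hx => ?_
    have hx2 : (1 + x) ^ 2 ≤ (1 + R) ^ 2 :=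
      pow_le_pow_left₀ (by linarith [hx.1]) (by linarith [hx.2]) 2
    have h1 := mul_le_mul_of_nonneg_right hx2 (sq_nonneg (iteratedDeriv j v x))
    have h2 := mul_le_mul_of_nonneg_right hjl (sq_nonneg (iteratedDeriv (j - 1) v x))
    have h3 := add_sq_le (a := (1 + x) * iteratedDeriv j v x)
      (b := j * iteratedDeriv (j - 1) v x)
    rw [mul_pow, mul_pow] at h3
    linarith
  rwa [intervalIntegral.integral_add (Continuous.intervalIntegrable (by fun_prop) _ _)
    (Continuous.intervalIntegrable (by fun_prop) _ _), intervalIntegral.integral_const_mul,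
    intervalIntegral.integral_const_mul] at mono

/-- Bound for the pairing of a source term with the weighted solution. -/
theorem exists_integral_source_le (l : ℕ) {R : ℝ} (hR : 0 < R) :
    ∃ C : ℝ, 0 ≤ C ∧ ∀ g v, Continuous g → SatisfiesBoundary l R v → ∀ j ≤ l,
      ∫ x in (0:ℝ)..R, g x * ((1 + x) * iteratedDeriv j v x + j * iteratedDeriv (j - 1) v x) ≤
        C * (√(∫ x in (0:ℝ)..R, g x ^ 2) * √(derivEnergy R j v)) := by
  refine ⟨√(2 * (1 + R) ^ 2 + 2 * l ^ 2 * (4 * R ^ 2)), by positivity, fun g v hg hv j hj => ?_⟩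
  have c0 := hv.continuous_iteratedDeriv j
  have c1 := hv.continuous_iteratedDeriv (j - 1)
  refine (integral_mul_le_sqrt hR hg (by fun_prop)).trans ?_
  rw [mul_left_comm, ← Real.sqrt_mul
    (show 0 ≤ 2 * (1 + R) ^ 2 + 2 * l ^ 2 * (4 * R ^ 2) by positivity) (derivEnergy R j v)]
  gcongr
  rcases j with _ | j
  · have e : ∀ x, ((1 + x) * iteratedDeriv 0 v x +
        ((0:ℕ):ℝ) * iteratedDeriv (0 - 1) v x) ^ 2 = (1 + x) ^ 2 * iteratedDeriv 0 v x ^ 2 :=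
      fun x => by simp; ring
    simp only [e]
    have h1 : ∫ x in (0:ℝ)..R, (1 + x) ^ 2 * iteratedDeriv 0 v x ^ 2 ≤
        ∫ x in (0:ℝ)..R, (1 + R) ^ 2 * iteratedDeriv 0 v x ^ 2 := by
      refine intervalIntegral.integral_mono_on hR.le
        (Continuous.intervalIntegrable (by fun_prop) _ _)
        (Continuous.intervalIntegrable (by fun_prop) _ _) fun x hx => ?_
      have := hx.1
      have := hx.2
      gcongr
    rw [intervalIntegral.integral_const_mul] at h1
    refine h1.trans (mul_le_mul_of_nonneg_right ?_ (derivEnergy_nonneg hR 0 v))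
    have : 0 ≤ 2 * (l:ℝ) ^ 2 * (4 * R ^ 2) := by positivity
    nlinarith [sq_nonneg (1 + R)]
  · refine (hv.integral_sq_weighted_le hR hj).trans ?_
    have h1 := hv.derivEnergy_le_succ hR (k := j) (by omega)
    have h2 := mul_le_mul_of_nonneg_left h1 (by positivity : 0 ≤ 2 * (l:ℝ) ^ 2)
    simp only [Nat.add_sub_cancel]
    linarith

/-- Lower-order terms are absorbed by an arbitrarily small multiple of the top-order energy. -/
theorem exists_integral_lower_le (l : ℕ) {R : ℝ} (hR : 0 < R) (K : ℝ) {η : ℝ} (hη : 0 < η) :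
    ∃ C : ℝ, 0 ≤ C ∧ ∀ b v w, Continuous b → (∀ x ∈ Icc (0:ℝ) R, |b x| ≤ K) →
      SatisfiesBoundary l R v → SatisfiesBoundary l R w → ∀ j < l, ∀ k ≤ l,
      2 * ∫ x in (0:ℝ)..R, b x * iteratedDeriv k w x *
          ((1 + x) * iteratedDeriv j v x + j * iteratedDeriv (j - 1) v x) ≤
        η * (derivEnergy R l w + derivEnergy R l v) +
          C * (derivEnergy R 0 w + derivEnergy R 0 v) := by
  obtain ⟨C₁, hC₁, H₁⟩ := exists_derivEnergy_le l hR one_pos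
  set M : ℝ := K ^ 2 / η * (2 * (1 + R) ^ 2 + 2 * l ^ 2) with hM
  have hM0 : 0 ≤ M := by positivity
  obtain ⟨C₂, hC₂, H₂⟩ := exists_derivEnergy_le l hR (ε := η / (M + 1)) (by positivity)
  refine ⟨η * C₁ + M * C₂, by positivity, fun b v w hb hbK hv hw j hj k hk => ?_⟩
  have c0 := hv.continuous_iteratedDeriv j
  have c1 := hv.continuous_iteratedDeriv (j - 1)
  have c2 := hw.continuous_iteratedDeriv k
  have mono : ∫ x in (0:ℝ)..R, 2 * (b x * iteratedDeriv k w x *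
          ((1 + x) * iteratedDeriv j v x + j * iteratedDeriv (j - 1) v x)) ≤
      ∫ x in (0:ℝ)..R, (η * iteratedDeriv k w x ^ 2 + K ^ 2 / η *
          ((1 + x) * iteratedDeriv j v x + j * iteratedDeriv (j - 1) v x) ^ 2) := by
    refine intervalIntegral.integral_mono_on hR.le
      (Continuous.intervalIntegrable (by fun_prop) _ _)
      (Continuous.intervalIntegrable (by fun_prop) _ _) fun x hx => ?_
    set p := (1 + x) * iteratedDeriv j v x + j * iteratedDeriv (j - 1) v x
    set d := iteratedDeriv k w x
    have hb2 : b x ^ 2 ≤ K ^ 2 := sq_le_sq' (by linarith [neg_abs_le (b x), hbK x hx])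
      (by linarith [le_abs_self (b x), hbK x hx])
    have h1 := mul_le_mul_of_nonneg_right hb2 (sq_nonneg p)
    have h2 : K ^ 2 / η * p ^ 2 = η * (K ^ 2 * p ^ 2 / η ^ 2) := by field_simp
    have h3 : b x ^ 2 * p ^ 2 / η ^ 2 ≤ K ^ 2 * p ^ 2 / η ^ 2 := by gcongr
    have h4 : 2 * (b x * d * p) = η * (2 * d * (b x * p / η)) := by field_simp
    rw [h2, h4, ← mul_add]
    refine mul_le_mul_of_nonneg_left ?_ hη.le
    have h5 : (b x * p / η) ^ 2 = b x ^ 2 * p ^ 2 / η ^ 2 := by rw [div_pow, mul_pow]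
    nlinarith [sq_nonneg (d - b x * p / η)]
  rw [intervalIntegral.integral_const_mul,
    intervalIntegral.integral_add (Continuous.intervalIntegrable (by fun_prop) _ _)
    (Continuous.intervalIntegrable (by fun_prop) _ _), intervalIntegral.integral_const_mul,
    intervalIntegral.integral_const_mul] at mono
  refine mono.trans ?_
  change η * derivEnergy R k w + _ ≤ _
  have hw0 := derivEnergy_nonneg hR 0 w
  have hwl := derivEnergy_nonneg hR l w
  have hv0 := derivEnergy_nonneg hR 0 v
  have hvl := derivEnergy_nonneg hR l v
  have g1 : derivEnergy R k w ≤ derivEnergy R l w + C₁ * derivEnergy R 0 w := by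
    rcases hk.lt_or_eq with hk' | rfl
    · simpa using H₁ w hw k hk'
    · linarith [mul_nonneg hC₁ hw0]
  have g2 : K ^ 2 / η * ∫ x in (0:ℝ)..R,
      ((1 + x) * iteratedDeriv j v x + j * iteratedDeriv (j - 1) v x) ^ 2 ≤
      M * (η / (M + 1) * derivEnergy R l v + C₂ * derivEnergy R 0 v) := by
    rw [hM, mul_assoc]
    refine mul_le_mul_of_nonneg_left ?_ (by positivity)
    refine (hv.integral_sq_weighted_le hR hj.le).trans ?_
    rw [← hM, add_mul]
    have a1 := H₂ v hv j hj
    have a2 := H₂ v hv (j - 1) (by omega)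
    gcongr
  have g3 : M * (η / (M + 1)) ≤ η := by
    rw [← mul_div_assoc, div_le_iff₀ (by positivity)]
    nlinarith
  have g4 := mul_le_mul_of_nonneg_right g3 hvl
  have g5 := mul_le_mul_of_nonneg_left g1 hη.le
  have g6 : 0 ≤ η * C₁ * derivEnergy R 0 v := by positivity
  have g7 : 0 ≤ M * C₂ * derivEnergy R 0 w := by positivity
  linarith

/-- The weighted energy inequality at a fixed time. -/
theorem exists_energy_inequality {n l : ℕ} (hl : 1 ≤ l) {R : ℝ} (hR : 0 < R)
    {A B : Fin n → ℝ} (hA : ∀ i, 0 < A i) (hB : ∀ i, B i ≤ 0) (K : ℝ) :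
    ∃ c C : ℝ, 0 < c ∧ 0 ≤ C ∧
      ∀ (b : ℕ → Fin n → Fin n → ℝ → ℝ) (f : Fin n → ℝ → ℝ) (G : ℕ → Fin n → ℝ → ℝ)
        (u w : Fin n → ℝ → ℝ),
      (∀ j < 2 * l, ∀ i m, ContDiff ℝ (⊤ : ℕ∞) (b j i m)) →
      (∀ j < 2 * l, ∀ i m, ∀ x ∈ Icc (0:ℝ) R, |b j i m x| ≤ K) →
      (∀ i, Continuous (f i)) →
      (∀ j ≤ l, ∀ i, ContDiff ℝ (⊤ : ℕ∞) (G j i)) →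
      (∀ i, SatisfiesBoundary l R (u i)) →
      (∀ i, ∀ x ∈ Icc (0:ℝ) R,
        w i x - (-1 : ℝ) ^ l * (A i * iteratedDeriv (2 * l + 1) (u i) x +
              B i * iteratedDeriv (2 * l) (u i) x) -
            ∑ j ∈ Finset.range l, (-1 : ℝ) ^ j *
              iteratedDeriv j (fun y => ∑ m : Fin n,
                (b (2 * j + 1) i m y * iteratedDeriv (j + 1) (u m) y +
                  b (2 * j) i m y * iteratedDeriv j (u m) y)) x =
          f i x + ∑ j ∈ Finset.range (l + 1), (-1 : ℝ) ^ j * iteratedDeriv j (G j i) x) →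
      ∑ i, 2 * ∫ x in (0:ℝ)..R, w i x * ((1 + x) * u i x) ≤
        -c * ∑ i, derivEnergy R l (u i) + C * ∑ i, derivEnergy R 0 (u i) +
        C * ∑ i, (√(∫ x in (0:ℝ)..R, f i x ^ 2) * √(derivEnergy R 0 (u i)) +
          ∑ j ∈ Finset.range (l + 1),
            √(∫ x in (0:ℝ)..R, G j i x ^ 2) * √(derivEnergy R j (u i))) := by
  obtain ⟨c₀, hc₀, hcA⟩ : ∃ c₀ : ℝ, 0 < c₀ ∧ ∀ i, c₀ ≤ A i := by
    rcases isEmpty_or_nonempty (Fin n) with h | h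
    · exact ⟨1, one_pos, fun i => h.elim i⟩
    · obtain ⟨i₀, hi₀⟩ := Finite.exists_min A
      exact ⟨A i₀, hA i₀, hi₀⟩
  obtain ⟨C₁, hC₁, H₁⟩ := exists_integral_source_le l hR
  obtain ⟨C₂, hC₂, H₂⟩ := exists_integral_lower_le l hR K
    (η := c₀ / (8 * l * n ^ 2 + 1)) (by positivity)
  set η : ℝ := c₀ / (8 * l * n ^ 2 + 1) with hη
  have hη0 : 0 < η := by positivity
  refine ⟨c₀ / 2, 4 * l * n ^ 2 * C₂ + 2 * C₁, by positivity, by positivity,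
    fun b f G u w hb hbK hf hG hu heq => ?_⟩
  set EL := ∑ i, derivEnergy R l (u i)
  set E0 := ∑ i, derivEnergy R 0 (u i) with hE0
  have hEL : ∀ i, derivEnergy R l (u i) ≤ EL := fun i =>
    Finset.single_le_sum (f := fun i => derivEnergy R l (u i))
      (fun i _ => derivEnergy_nonneg hR l (u i)) (Finset.mem_univ i)
  have hE0' : ∀ i, derivEnergy R 0 (u i) ≤ E0 := fun i =>
    Finset.single_le_sum (f := fun i => derivEnergy R 0 (u i))
      (fun i _ => derivEnergy_nonneg hR 0 (u i)) (Finset.mem_univ i)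
  have hEL0 : 0 ≤ EL := Finset.sum_nonneg fun i _ => derivEnergy_nonneg hR l (u i)
  have hE00 : 0 ≤ E0 := Finset.sum_nonneg fun i _ => derivEnergy_nonneg hR 0 (u i)
  set S : Fin n → ℝ := fun i => √(∫ x in (0:ℝ)..R, f i x ^ 2) * √(derivEnergy R 0 (u i)) +
          ∑ j ∈ Finset.range (l + 1),
            √(∫ x in (0:ℝ)..R, G j i x ^ 2) * √(derivEnergy R j (u i)) with hS
  have hS0 : ∀ i, 0 ≤ S i := fun i => by positivity
  have key : ∀ i, 2 * ∫ x in (0:ℝ)..R, w i x * ((1 + x) * u i x) ≤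
      -c₀ * derivEnergy R l (u i) + 4 * l * n * (η * EL + C₂ * E0) + 2 * C₁ * S i := by
    intro i
    set F : ℕ → ℝ → ℝ := fun j y => ∑ m : Fin n,
                (b (2 * j + 1) i m y * iteratedDeriv (j + 1) (u m) y +
                  b (2 * j) i m y * iteratedDeriv j (u m) y) with hF
    have hFs : ∀ j < l, ContDiff ℝ (⊤ : ℕ∞) (F j) := fun j hj =>
      ContDiff.sum fun m _ =>
        ((hb _ (by omega) i m).mul ((hu m).smooth.contDiff_top_iteratedDeriv _)).add
        ((hb _ (by omega) i m).mul ((hu m).smooth.contDiff_top_iteratedDeriv _))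
    have cu : Continuous (u i) := (hu i).smooth.continuous
    have cd := (hu i).continuous_iteratedDeriv
    have e1 : ∫ x in (0:ℝ)..R, w i x * ((1 + x) * u i x) =
        ∫ x in (0:ℝ)..R, (A i * (((-1) ^ l * iteratedDeriv (2 * l + 1) (u i) x) *
            ((1 + x) * u i x)) +
          B i * (((-1) ^ l * iteratedDeriv (2 * l) (u i) x) * ((1 + x) * u i x)) +
          (∑ j ∈ Finset.range l, ((-1) ^ j * iteratedDeriv j (F j) x) * ((1 + x) * u i x)) +
          f i x * ((1 + x) * u i x) +
          ∑ j ∈ Finset.range (l + 1),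
            ((-1) ^ j * iteratedDeriv j (G j i) x) * ((1 + x) * u i x)) := by
      refine intervalIntegral.integral_congr fun x hx => ?_
      rw [uIcc_of_le hR.le] at hx
      have := heq i x hx
      simp only [← Finset.sum_mul]
      linear_combination ((1 + x) * u i x) * this
    have cF : ∀ j ∈ Finset.range l, Continuous fun x =>
        ((-1) ^ j * iteratedDeriv j (F j) x) * ((1 + x) * u i x) := fun j hj => by
      have := (hFs j (by simpa using hj)).continuous_iteratedDeriv_top j
      fun_prop
    have cG : ∀ j ∈ Finset.range (l + 1), Continuous fun x =>
        ((-1) ^ j * iteratedDeriv j (G j i) x) * ((1 + x) * u i x) := fun j hj => by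
      have := (hG j (by simpa [Nat.lt_succ_iff] using hj) i).continuous_iteratedDeriv_top j
      fun_prop
    have cFs := continuous_finsetSum _ cF
    have cGs := continuous_finsetSum _ cG
    have cf := hf i
    rw [intervalIntegral.integral_add (Continuous.intervalIntegrable (by fun_prop) _ _)
        (cGs.intervalIntegrable _ _),
      intervalIntegral.integral_add (Continuous.intervalIntegrable (by fun_prop) _ _)
        (Continuous.intervalIntegrable (by fun_prop) _ _),
      intervalIntegral.integral_add (Continuous.intervalIntegrable (by fun_prop) _ _)
        (cFs.intervalIntegrable _ _),
      intervalIntegral.integral_add (Continuous.intervalIntegrable (by fun_prop) _ _)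
        (Continuous.intervalIntegrable (by fun_prop) _ _),
      intervalIntegral.integral_const_mul, intervalIntegral.integral_const_mul,
      intervalIntegral.integral_finsetSum fun j hj => (cF j hj).intervalIntegrable _ _,
      intervalIntegral.integral_finsetSum fun j hj => (cG j hj).intervalIntegrable _ _] at e1
    have t1 := mul_le_mul_of_nonneg_left ((hu i).integral_leading_le hl hR) (hA i).le
    have t2 := mul_nonpos_of_nonpos_of_nonneg (hB i) ((hu i).integral_even_nonneg hl hR)
    have t3 : 2 * ∑ j ∈ Finset.range l, ∫ x in (0:ℝ)..R,
        ((-1) ^ j * iteratedDeriv j (F j) x) * ((1 + x) * u i x) ≤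
        4 * l * n * (η * EL + C₂ * E0) := by
      rw [Finset.mul_sum]
      refine (Finset.sum_le_card_nsmul _ _ (4 * n * (η * EL + C₂ * E0)) fun j hj => ?_).trans_eq
        (by simp; ring)
      have hj : j < l := by simpa using hj
      rw [(hu i).integral_iteratedDeriv_mul_weighted (hFs j hj) hj.le]
      set P : ℝ → ℝ := fun x =>
        (1 + x) * iteratedDeriv j (u i) x + j * iteratedDeriv (j - 1) (u i) x with hP
      have e2 : ∀ x, F j x * ((1 + x) * iteratedDeriv j (u i) x +
          j * iteratedDeriv (j - 1) (u i) x) = ∑ m,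
          (b (2 * j + 1) i m x * iteratedDeriv (j + 1) (u m) x * P x +
            b (2 * j) i m x * iteratedDeriv j (u m) x * P x) := fun x =>
        (Finset.sum_mul _ _ _).trans (Finset.sum_congr rfl fun m _ => add_mul _ _ _)
      simp only [e2]
      have cb : ∀ k < 2 * l, ∀ m, Continuous (b k i m) := fun k hk m => (hb k hk i m).continuous
      have cc : ∀ k < 2 * l, ∀ m p, Continuous fun x => b k i m x * iteratedDeriv p (u m) x * P x :=
        fun k hk m p => by
          have := cb k hk m
          have := (hu m).continuous_iteratedDeriv p
          have := cd j
          have := cd (j - 1)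
          fun_prop
      have cc2 : ∀ m, Continuous fun x =>
          b (2 * j + 1) i m x * iteratedDeriv (j + 1) (u m) x * P x +
            b (2 * j) i m x * iteratedDeriv j (u m) x * P x := fun m =>
        (cc (2 * j + 1) (by omega) m (j + 1)).add (cc (2 * j) (by omega) m j)
      rw [intervalIntegral.integral_finsetSum fun m _ => (cc2 m).intervalIntegrable _ _,
        Finset.mul_sum]
      refine (Finset.sum_le_card_nsmul _ _ (4 * (η * EL + C₂ * E0)) fun m _ => ?_).trans_eq
        (by simp; ring)
      rw [intervalIntegral.integral_add
        ((cc (2 * j + 1) (by omega) m (j + 1)).intervalIntegrable _ _)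
        ((cc (2 * j) (by omega) m j).intervalIntegrable _ _)]
      have a1 := H₂ (b (2 * j + 1) i m) (u i) (u m) (cb _ (by omega) m) (hbK _ (by omega) i m)
        (hu i) (hu m) j hj (j + 1) (by omega)
      have a2 := H₂ (b (2 * j) i m) (u i) (u m) (cb _ (by omega) m) (hbK _ (by omega) i m)
        (hu i) (hu m) j hj j (by omega)
      have b1 : η * (derivEnergy R l (u m) + derivEnergy R l (u i)) ≤ η * (EL + EL) := by
        gcongr <;> apply hEL
      have b2 : C₂ * (derivEnergy R 0 (u m) + derivEnergy R 0 (u i)) ≤ C₂ * (E0 + E0) := by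
        gcongr <;> apply hE0'
      linarith
    have t4 : ∫ x in (0:ℝ)..R, f i x * ((1 + x) * u i x) ≤
        C₁ * (√(∫ x in (0:ℝ)..R, f i x ^ 2) * √(derivEnergy R 0 (u i))) := by
      simpa using H₁ (f i) (u i) (hf i) (hu i) 0 (by omega)
    have t5 : ∑ j ∈ Finset.range (l + 1), ∫ x in (0:ℝ)..R,
        ((-1) ^ j * iteratedDeriv j (G j i) x) * ((1 + x) * u i x) ≤
        C₁ * ∑ j ∈ Finset.range (l + 1),
            √(∫ x in (0:ℝ)..R, G j i x ^ 2) * √(derivEnergy R j (u i)) := by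
      rw [Finset.mul_sum]
      refine Finset.sum_le_sum fun j hj => ?_
      have hj : j ≤ l := by simpa [Nat.lt_succ_iff] using hj
      rw [(hu i).integral_iteratedDeriv_mul_weighted (hG j hj i) hj]
      exact H₁ (G j i) (u i) (hG j hj i).continuous (hu i) j hj
    have t6 := mul_le_mul_of_nonneg_right (hcA i) (derivEnergy_nonneg hR l (u i))
    rw [e1]
    simp only [hS, mul_add]
    linarith
  have hsum := Finset.sum_le_sum fun i (_ : i ∈ Finset.univ) => key i
  refine hsum.trans ?_
  rw [Finset.sum_add_distrib, Finset.sum_add_distrib, ← Finset.mul_sum Finset.univ _ (-c₀),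
    ← Finset.mul_sum Finset.univ _ (2 * C₁), Finset.sum_const, Finset.card_univ, Fintype.card_fin, nsmul_eq_mul]
  change -c₀ * EL + _ + _ ≤ _
  have r1 : 8 * l * n ^ 2 * η ≤ c₀ := by
    rw [hη, ← mul_div_assoc, div_le_iff₀ (by positivity)]
    nlinarith
  have r2 := mul_le_mul_of_nonneg_right r1 hEL0
  have r3 : 0 ≤ 2 * C₁ * E0 := by positivity
  have r4 : 0 ≤ 4 * l * n ^ 2 * C₂ * ∑ i, S i :=
    mul_nonneg (by positivity) (Finset.sum_nonneg fun i _ => hS0 i)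
  linarith

/-- An integrated Gronwall inequality with a dissipation term. -/
theorem gronwall_dissipation {T c C : ℝ} (hT : 0 < T) (hc : 0 ≤ c) (hC : 0 ≤ C)
    {y h E g : ℝ → ℝ} (hy : ∀ t, HasDerivAt y (h t) t) (hh : Continuous h) (hE : Continuous E)
    (hg : Continuous g) (hE0 : ∀ t, 0 ≤ E t) (hg0 : ∀ t, 0 ≤ g t) (hy0 : y 0 = 0)
    (hyn : ∀ t ∈ Icc 0 T, 0 ≤ y t)
    (hle : ∀ t ∈ Icc 0 T, h t ≤ -c * E t + C * y t + C * g t) :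
    (∀ t ∈ Icc 0 T, y t ≤ Real.exp (C * T) * (C * ∫ s in (0:ℝ)..T, g s)) ∧
      c * ∫ s in (0:ℝ)..T, E s ≤ Real.exp (C * T) * (C * ∫ s in (0:ℝ)..T, g s) := by
  have cy : Continuous y := continuous_iff_continuousAt.2 fun t => (hy t).continuousAt
  have main : ∀ t ∈ Icc 0 T, Real.exp (-(C * t)) * y t +
      Real.exp (-(C * T)) * (c * ∫ s in (0:ℝ)..t, E s) ≤ C * ∫ s in (0:ℝ)..T, g s := by
    intro t ht
    have hd : ∀ s, HasDerivAt (fun s => Real.exp (-(C * s)) * y s)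
        (Real.exp (-(C * s)) * (h s - C * y s)) s := fun s => by
      have h1 : HasDerivAt (fun s => -(C * s)) (-(C * 1)) s :=
        ((hasDerivAt_id s).const_mul C).neg
      refine HasDerivAt.congr_deriv (h1.exp.mul (hy s)) ?_
      ring
    have ftc := intervalIntegral.integral_eq_sub_of_hasDerivAt (a := 0) (b := t)
      (fun s _ => hd s) (Continuous.intervalIntegrable (by fun_prop) _ _)
    rw [hy0, mul_zero, sub_zero] at ftc
    have mono : ∫ s in (0:ℝ)..t, Real.exp (-(C * s)) * (h s - C * y s) ≤
        ∫ s in (0:ℝ)..t, (C * g s - Real.exp (-(C * T)) * c * E s) := by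
      refine intervalIntegral.integral_mono_on ht.1
        (Continuous.intervalIntegrable (by fun_prop) _ _)
        (Continuous.intervalIntegrable (by fun_prop) _ _) fun s hs => ?_
      have hsT : s ∈ Icc 0 T := ⟨hs.1, hs.2.trans ht.2⟩
      have e1 : Real.exp (-(C * s)) ≤ 1 := by
        rw [Real.exp_le_one_iff]
        have := mul_nonneg hC hs.1
        linarith
      have e2 : Real.exp (-(C * T)) ≤ Real.exp (-(C * s)) := by
        rw [Real.exp_le_exp]
        have := mul_le_mul_of_nonneg_left hsT.2 hC
        linarith
      have e3 := mul_le_mul_of_nonneg_right e1 (mul_nonneg hC (hg0 s))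
      have e4 := mul_le_mul_of_nonneg_right e2 (mul_nonneg hc (hE0 s))
      have e5 := mul_le_mul_of_nonneg_left (hle s hsT) (Real.exp_pos (-(C * s))).le
      linarith
    rw [ftc, intervalIntegral.integral_sub (Continuous.intervalIntegrable (by fun_prop) _ _)
      (Continuous.intervalIntegrable (by fun_prop) _ _), intervalIntegral.integral_const_mul,
      intervalIntegral.integral_const_mul] at mono
    have hsub : ∫ s in (0:ℝ)..t, g s ≤ ∫ s in (0:ℝ)..T, g s :=
      intervalIntegral.integral_mono_interval le_rfl ht.1 ht.2
        (Filter.Eventually.of_forall hg0) (hg.intervalIntegrable _ _)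
    have := mul_le_mul_of_nonneg_left hsub hC
    linarith
  have hcancel : Real.exp (C * T) * Real.exp (-(C * T)) = 1 := by
    rw [← Real.exp_add]
    simp
  constructor
  · intro t ht
    have h1 := main t ht
    have h2 : 0 ≤ ∫ s in (0:ℝ)..t, E s := intervalIntegral.integral_nonneg ht.1 fun s _ => hE0 s
    have h3 : Real.exp (-(C * T)) * y t ≤ Real.exp (-(C * t)) * y t := by
      refine mul_le_mul_of_nonneg_right ?_ (hyn t ht)
      rw [Real.exp_le_exp]
      have := mul_le_mul_of_nonneg_left ht.2 hC
      linarith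
    have h4 : 0 ≤ Real.exp (-(C * T)) * (c * ∫ s in (0:ℝ)..t, E s) := by positivity
    calc y t = Real.exp (C * T) * (Real.exp (-(C * T)) * y t) := by
          rw [← mul_assoc, hcancel, one_mul]
      _ ≤ _ := mul_le_mul_of_nonneg_left (by linarith) (Real.exp_pos _).le
  · have hTT : T ∈ Icc 0 T := ⟨hT.le, le_rfl⟩
    have h1 := main T hTT
    have h2 := mul_nonneg (Real.exp_pos (-(C * T))).le (hyn T hTT)
    calc c * ∫ s in (0:ℝ)..T, E s =
          Real.exp (C * T) * (Real.exp (-(C * T)) * (c * ∫ s in (0:ℝ)..T, E s)) := by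
          rw [← mul_assoc, hcancel, one_mul]
      _ ≤ _ := mul_le_mul_of_nonneg_left (by linarith) (Real.exp_pos _).le

theorem memLp_restrict_Ioc_of_continuous {T : ℝ} {f : ℝ → ℝ} (hf : Continuous f)
    (p : ENNReal) : MemLp f p (volume.restrict (Ioc 0 T)) := by
  obtain ⟨M, hM⟩ := (isCompact_Icc (a := (0:ℝ)) (b := T)).exists_bound_of_continuousOn
    hf.continuousOn
  exact MemLp.of_bound hf.aestronglyMeasurable M
    ((ae_restrict_iff' measurableSet_Ioc).2 (.of_forall fun t ht => hM t (Ioc_subset_Icc_self ht)))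

/-- Hölder's inequality in time combined with an interpolation inequality. -/
theorem integral_mul_le_of_pow_le {T X : ℝ} (hT : 0 < T) (hX : 0 ≤ X) {l j : ℕ} (hl : 1 ≤ l)
    (hj : j ≤ l) {γ s r : ℝ → ℝ} (hγ : Continuous γ) (hs : Continuous s) (hr : Continuous r)
    (hγ0 : ∀ t, 0 ≤ γ t) (hs0 : ∀ t, 0 ≤ s t) (hr0 : ∀ t, 0 ≤ r t)
    (hsr : ∀ t ∈ Icc 0 T, s t ^ l ≤ r t ^ j * X ^ (l - j))
    (hrX : ∫ t in (0:ℝ)..T, r t ^ 2 ≤ X ^ 2) :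
    ∫ t in (0:ℝ)..T, γ t * s t ≤
      (∫ t in (0:ℝ)..T, γ t ^ (2 * (l:ℝ) / (2 * (l:ℝ) - (j:ℝ)))) ^
        (1 / (2 * (l:ℝ) / (2 * (l:ℝ) - (j:ℝ)))) * X := by
  have hl0 : (0:ℝ) < l := by exact_mod_cast hl
  rcases Nat.eq_zero_or_pos j with rfl | hj0
  · have e : 2 * (l:ℝ) / (2 * (l:ℝ) - ((0:ℕ):ℝ)) = 1 := by
      rw [Nat.cast_zero, sub_zero, div_self (by positivity)]
    simp only [e, Real.rpow_one, div_one]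
    rw [← intervalIntegral.integral_mul_const]
    refine intervalIntegral.integral_mono_on hT.le
      (Continuous.intervalIntegrable (by fun_prop) _ _)
      (Continuous.intervalIntegrable (by fun_prop) _ _) fun t ht => ?_
    refine mul_le_mul_of_nonneg_left ?_ (hγ0 t)
    exact le_of_pow_le_pow_left₀ (n := l) (by omega) hX (by simpa using hsr t ht)
  have hj0' : (0:ℝ) < j := by exact_mod_cast hj0
  have hjl : (j:ℝ) ≤ l := by exact_mod_cast hj
  have hpq : (2 * (l:ℝ) / (2 * (l:ℝ) - (j:ℝ))).HolderConjugate (2 * l / j) := by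
    have hd : 0 < 2 * (l:ℝ) - j := by linarith
    rw [Real.holderConjugate_iff]
    constructor
    · rw [lt_div_iff₀ hd]
      linarith
    · rw [inv_div, inv_div]
      field_simp
      ring
  have holder := integral_mul_le_Lp_mul_Lq_of_nonneg (μ := volume.restrict (Ioc 0 T)) hpq
    (.of_forall hγ0) (.of_forall hs0) (memLp_restrict_Ioc_of_continuous hγ _)
    (memLp_restrict_Ioc_of_continuous hs _)
  simp only [← intervalIntegral.integral_of_le hT.le] at holder
  refine holder.trans (mul_le_mul_of_nonneg_left ?_ (Real.rpow_nonneg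
    (intervalIntegral.integral_nonneg hT.le fun t _ => Real.rpow_nonneg (hγ0 t) _) _))
  have hpt : ∀ t ∈ Icc 0 T, s t ^ (2 * (l:ℝ) / j) ≤
      r t ^ 2 * (X ^ (l - j)) ^ (2 / (j:ℝ)) := by
    intro t ht
    have e1 : s t ^ (2 * (l:ℝ) / j) = (s t ^ l) ^ (2 / (j:ℝ)) := by
      rw [← Real.rpow_natCast, ← Real.rpow_mul (hs0 t)]
      congr 1
      ring
    have e2 : r t ^ 2 = (r t ^ j) ^ (2 / (j:ℝ)) := by
      rw [← Real.rpow_natCast, ← Real.rpow_natCast, ← Real.rpow_mul (hr0 t)]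
      congr 1
      push_cast
      field_simp
    rw [e1, e2, ← Real.mul_rpow (pow_nonneg (hr0 t) _) (pow_nonneg hX _)]
    exact Real.rpow_le_rpow (pow_nonneg (hs0 t) _) (hsr t ht) (by positivity)
  have hint : ∫ t in (0:ℝ)..T, s t ^ (2 * (l:ℝ) / j) ≤ (X ^ l) ^ (2 / (j:ℝ)) := by
    have h1 : ∫ t in (0:ℝ)..T, s t ^ (2 * (l:ℝ) / j) ≤
        ∫ t in (0:ℝ)..T, r t ^ 2 * (X ^ (l - j)) ^ (2 / (j:ℝ)) :=
      intervalIntegral.integral_mono_on hT.le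
        ((hs.rpow_const fun _ => Or.inr (by positivity)).intervalIntegrable _ _)
        (Continuous.intervalIntegrable (by fun_prop) _ _) hpt
    rw [intervalIntegral.integral_mul_const] at h1
    refine h1.trans ((mul_le_mul_of_nonneg_right hrX
      (Real.rpow_nonneg (pow_nonneg hX _) _)).trans_eq ?_)
    have e2 : X ^ 2 = (X ^ j) ^ (2 / (j:ℝ)) := by
      rw [← Real.rpow_natCast, ← Real.rpow_natCast, ← Real.rpow_mul hX]
      congr 1
      push_cast
      field_simp
    rw [e2, ← Real.mul_rpow (pow_nonneg hX _) (pow_nonneg hX _), ← pow_add,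
      Nat.add_sub_cancel' hj]
  calc (∫ t in (0:ℝ)..T, s t ^ (2 * (l:ℝ) / j)) ^ (1 / (2 * (l:ℝ) / j)) ≤
        ((X ^ l) ^ (2 / (j:ℝ))) ^ (1 / (2 * (l:ℝ) / j)) :=
        Real.rpow_le_rpow (intervalIntegral.integral_nonneg hT.le fun t _ =>
          Real.rpow_nonneg (hs0 t) _) hint (by positivity)
    _ = X := by
      rw [← Real.rpow_natCast, ← Real.rpow_mul hX, ← Real.rpow_mul hX]
      convert Real.rpow_one X using 2
      field_simp

section TwoVariables

variable {F : ℝ → ℝ → ℝ}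

theorem hasDerivAt_snd (hF : ContDiff ℝ (⊤ : ℕ∞) fun p : ℝ × ℝ => F p.1 p.2) (t x : ℝ) :
    HasDerivAt (F t) (fderiv ℝ (fun p : ℝ × ℝ => F p.1 p.2) (t, x) (0, 1)) x :=
  HasFDerivAt.comp_hasDerivAt (l := fun p : ℝ × ℝ => F p.1 p.2) (f := fun y => (t, y)) x
    (hF.differentiable (by simp) (t, x)).hasFDerivAt ((hasDerivAt_const x t).prodMk (hasDerivAt_id x))

theorem hasDerivAt_fst (hF : ContDiff ℝ (⊤ : ℕ∞) fun p : ℝ × ℝ => F p.1 p.2) (t x : ℝ) :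
    HasDerivAt (fun s => F s x) (fderiv ℝ (fun p : ℝ × ℝ => F p.1 p.2) (t, x) (1, 0)) t :=
  HasFDerivAt.comp_hasDerivAt (l := fun p : ℝ × ℝ => F p.1 p.2) (f := fun s => (s, x)) t
    (hF.differentiable (by simp) (t, x)).hasFDerivAt ((hasDerivAt_id t).prodMk (hasDerivAt_const t x))

theorem contDiff_section (hF : ContDiff ℝ (⊤ : ℕ∞) fun p : ℝ × ℝ => F p.1 p.2) (t : ℝ) :
    ContDiff ℝ (⊤ : ℕ∞) (F t) :=
  hF.comp (contDiff_const.prodMk contDiff_id)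

theorem contDiff_deriv_fst (hF : ContDiff ℝ (⊤ : ℕ∞) fun p : ℝ × ℝ => F p.1 p.2) :
    ContDiff ℝ (⊤ : ℕ∞) fun p : ℝ × ℝ => deriv (fun s => F s p.2) p.1 := by
  simp only [fun p : ℝ × ℝ => (hasDerivAt_fst hF p.1 p.2).deriv]
  exact (hF.fderiv_right (by simp)).clm_apply contDiff_const

theorem contDiff_iteratedDeriv_snd (hF : ContDiff ℝ (⊤ : ℕ∞) fun p : ℝ × ℝ => F p.1 p.2)
    (k : ℕ) : ContDiff ℝ (⊤ : ℕ∞) fun p : ℝ × ℝ => iteratedDeriv k (F p.1) p.2 := by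
  induction k with
  | zero => simpa using hF
  | succ k ih =>
    simp only [iteratedDeriv_succ]
    simp only [fun p : ℝ × ℝ =>
      (hasDerivAt_snd (F := fun t x => iteratedDeriv k (F t) x) ih p.1 p.2).deriv]
    exact (ih.fderiv_right (by simp)).clm_apply contDiff_const

/-- Differentiation under the integral sign for smooth integrands. -/
theorem hasDerivAt_integral_of_contDiff
    (hF : ContDiff ℝ (⊤ : ℕ∞) fun p : ℝ × ℝ => F p.1 p.2) (a b t : ℝ) :
    HasDerivAt (fun s => ∫ x in a..b, F s x) (∫ x in a..b, deriv (fun s => F s x) t) t := by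
  have cD := (contDiff_deriv_fst hF).continuous
  obtain ⟨M, hM⟩ := ((isCompact_closedBall t 1).prod
    (isCompact_uIcc (a := a) (b := b))).exists_bound_of_continuousOn cD.continuousOn
  refine (intervalIntegral.hasDerivAt_integral_of_dominated_loc_of_deriv_le
    (F' := fun s x => deriv (fun s => F s x) s) (bound := fun _ => M)
    (Metric.closedBall_mem_nhds t one_pos) ?_ ?_ ?_ ?_ ?_ ?_).2
  · exact .of_forall fun s => (contDiff_section hF s).continuous.aestronglyMeasurable
  · exact (contDiff_section hF t).continuous.intervalIntegrable _ _
  · exact (cD.comp (continuous_const.prodMk continuous_id)).aestronglyMeasurable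
  · exact .of_forall fun x hx s hs => hM (s, x) ⟨hs, uIoc_subset_uIcc hx⟩
  · exact intervalIntegrable_const
  · exact .of_forall fun x _ s _ => (hasDerivAt_fst hF s x).differentiableAt.hasDerivAt

end TwoVariables

/-- The a priori estimate of Theorem 2.1 of the paper for the system with variable
lower-order coefficients, specialized to smooth classical solutions with zero initial
and boundary data.  Here `A i` and `B i` are the diagonal entries of `a_{2l+1}` and
`a_{2l}`, and `a j i m` is the `(i,m)` entry of the matrix `a_j`, `j = 0,…,2l−1`. -/
theorem system_apriori_estimate (n l : ℕ) (hn : 1 ≤ n) (hl : 1 ≤ l)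
    (R T : ℝ) (hR : 0 < R) (hT : 0 < T)
    (A B : Fin n → ℝ) (hA : ∀ i, 0 < A i) (hB : ∀ i, B i ≤ 0)
    (a : ℕ → Fin n → Fin n → ℝ → ℝ → ℝ)
    (ha : ∀ j < 2 * l, ∀ i m : Fin n, ContDiff ℝ (⊤ : ℕ∞) fun p : ℝ × ℝ => a j i m p.1 p.2) :
    ∃ c : ℝ, 0 < c ∧
      ∀ (f : Fin n → ℝ → ℝ → ℝ) (G : ℕ → Fin n → ℝ → ℝ → ℝ) (u : Fin n → ℝ → ℝ → ℝ),
      (∀ i, ContDiff ℝ (⊤ : ℕ∞) fun p : ℝ × ℝ => f i p.1 p.2) →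
      (∀ j ≤ l, ∀ i, ContDiff ℝ (⊤ : ℕ∞) fun p : ℝ × ℝ => G j i p.1 p.2) →
      (∀ i, ContDiff ℝ (⊤ : ℕ∞) fun p : ℝ × ℝ => u i p.1 p.2) →
      (∀ i, ∀ t ∈ Icc (0:ℝ) T, ∀ x ∈ Icc (0:ℝ) R,
        deriv (fun s => u i s x) t -
            (-1 : ℝ) ^ l * (A i * iteratedDeriv (2 * l + 1) (u i t) x +
              B i * iteratedDeriv (2 * l) (u i t) x) -
            ∑ j ∈ Finset.range l, (-1 : ℝ) ^ j *
              iteratedDeriv j (fun y => ∑ m : Fin n,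
                (a (2 * j + 1) i m t y * iteratedDeriv (j + 1) (u m t) y +
                  a (2 * j) i m t y * iteratedDeriv j (u m t) y)) x =
          f i t x +
            ∑ j ∈ Finset.range (l + 1), (-1 : ℝ) ^ j * iteratedDeriv j (G j i t) x) →
      (∀ i, ∀ x ∈ Icc (0:ℝ) R, u i 0 x = 0) →
      (∀ i, ∀ t ∈ Icc (0:ℝ) T, ∀ j < l, iteratedDeriv j (u i t) 0 = 0) →
      (∀ i, ∀ t ∈ Icc (0:ℝ) T, ∀ j ≤ l, iteratedDeriv j (u i t) R = 0) →
      (∑ i : Fin n, XNorm l R T (u i)) ≤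
        c * ((∫ t in (0:ℝ)..T, Real.sqrt (∫ x in (0:ℝ)..R, ∑ i : Fin n, (f i t x) ^ 2)) +
          ∑ j ∈ Finset.range (l + 1),
            mixedNorm ((2 * (l : ℝ)) / (2 * (l : ℝ) - (j : ℝ))) R T
              (fun t x => Real.sqrt (∑ i : Fin n, (G j i t x) ^ 2))) := by
  obtain ⟨K, hK⟩ : ∃ K : ℝ, ∀ j < 2 * l, ∀ i m : Fin n, ∀ t ∈ Icc (0:ℝ) T, ∀ x ∈ Icc (0:ℝ) R,
      |a j i m t x| ≤ K := by
    have h : ∀ q : Fin (2 * l) × Fin n × Fin n, ∃ K : ℝ, ∀ p ∈ Icc (0:ℝ) T ×ˢ Icc (0:ℝ) R,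
        ‖a q.1 q.2.1 q.2.2 p.1 p.2‖ ≤ K := fun q =>
      (isCompact_Icc.prod isCompact_Icc).exists_bound_of_continuousOn
        (ha q.1 q.1.2 q.2.1 q.2.2).continuous.continuousOn
    choose K hK using h
    obtain ⟨M, hM⟩ := (Set.finite_range K).bddAbove
    exact ⟨M, fun j hj i m t ht x hx =>
      (hK (⟨j, hj⟩, i, m) (t, x) ⟨ht, hx⟩).trans (hM ⟨_, rfl⟩)⟩
  obtain ⟨c, C, hc, hC, energy⟩ := exists_energy_inequality (n := n) hl hR hA hB K
  set D : ℝ := (1 + 1 / c) * (Real.exp (C * T) * (C * n)) with hD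
  have hD0 : 0 ≤ D := by positivity
  refine ⟨2 * n * D + 1, by positivity, fun f G u hf hG hu heq hinit hleft hright => ?_⟩
  have hbd : ∀ t ∈ Icc (0:ℝ) T, ∀ i, SatisfiesBoundary l R (u i t) := fun t ht i =>
    ⟨contDiff_section (hu i) t, hleft i t ht, hright i t ht⟩
  have contE : ∀ k i, Continuous fun t => derivEnergy R k (u i t) := fun k i =>
    intervalIntegral.continuous_parametric_intervalIntegral_of_continuous'
      ((contDiff_iteratedDeriv_snd (hu i) k).continuous.pow 2) 0 R
  set φ : ℝ → ℝ := fun t => √(∫ x in (0:ℝ)..R, ∑ i : Fin n, (f i t x) ^ 2)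
  set γ : ℕ → ℝ → ℝ := fun j t => √(∫ x in (0:ℝ)..R, ∑ i : Fin n, (G j i t x) ^ 2) with hγ
  have contφ : Continuous φ := Real.continuous_sqrt.comp
    (intervalIntegral.continuous_parametric_intervalIntegral_of_continuous'
      (continuous_finsetSum _ fun i _ => (hf i).continuous.pow 2) 0 R)
  have contγ : ∀ j ≤ l, Continuous (γ j) := fun j hj => Real.continuous_sqrt.comp
    (intervalIntegral.continuous_parametric_intervalIntegral_of_continuous'
      (continuous_finsetSum _ fun i _ => (hG j hj i).continuous.pow 2) 0 R)
  have comp_le : ∀ F : Fin n → ℝ → ℝ, (∀ i, Continuous (F i)) → ∀ i,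
      √(∫ x in (0:ℝ)..R, F i x ^ 2) ≤ √(∫ x in (0:ℝ)..R, ∑ i, F i x ^ 2) := fun F hF i =>
    Real.sqrt_le_sqrt (intervalIntegral.integral_mono_on hR.le
      (Continuous.intervalIntegrable (by fun_prop) _ _)
      (Continuous.intervalIntegrable (by fun_prop) _ _) fun x _ =>
        Finset.single_le_sum (f := fun i => F i x ^ 2) (fun i _ => sq_nonneg _)
          (Finset.mem_univ i))
  have mixed_eq : ∀ j : ℕ, mixedNorm ((2 * (l : ℝ)) / (2 * (l : ℝ) - (j : ℝ))) R T
      (fun t x => √(∑ i : Fin n, (G j i t x) ^ 2)) =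
      (∫ t in (0:ℝ)..T, γ j t ^ (2 * (l:ℝ) / (2 * (l:ℝ) - (j:ℝ)))) ^
        (1 / (2 * (l:ℝ) / (2 * (l:ℝ) - (j:ℝ)))) := fun j => by
    have h0 : ∀ t x, 0 ≤ ∑ i : Fin n, (G j i t x) ^ 2 := fun t x =>
      Finset.sum_nonneg fun i _ => sq_nonneg _
    simp only [mixedNorm, hγ, fun t x => Real.sq_sqrt (h0 t x)]
    congr 2
    ext t
    rw [Real.sqrt_eq_rpow, ← Real.rpow_mul (intervalIntegral.integral_nonneg hR.le
      fun x _ => h0 t x)]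
    congr 1
    ring
  set N : ℝ := (∫ t in (0:ℝ)..T, φ t) + ∑ j ∈ Finset.range (l + 1),
    mixedNorm ((2 * (l : ℝ)) / (2 * (l : ℝ) - (j : ℝ))) R T
      (fun t x => √(∑ i : Fin n, (G j i t x) ^ 2)) with hN
  have hN0 : 0 ≤ N := by
    refine add_nonneg (intervalIntegral.integral_nonneg hT.le fun t _ => Real.sqrt_nonneg _)
      (Finset.sum_nonneg fun j _ => ?_)
    rw [mixed_eq]
    exact Real.rpow_nonneg (intervalIntegral.integral_nonneg hT.le fun t _ =>
      Real.rpow_nonneg (Real.sqrt_nonneg _) _) _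
  set g : ℝ → ℝ := fun t => ∑ i, (φ t * √(derivEnergy R 0 (u i t)) +
    ∑ j ∈ Finset.range (l + 1), γ j t * √(derivEnergy R j (u i t))) with hg
  have contφs : ∀ i, Continuous fun t => φ t * √(derivEnergy R 0 (u i t)) := fun i =>
    contφ.mul (contE 0 i).sqrt
  have contγs : ∀ i, ∀ j ∈ Finset.range (l + 1),
      Continuous fun t => γ j t * √(derivEnergy R j (u i t)) := fun i j hj =>
    (contγ j (by simpa [Nat.lt_succ_iff] using hj)).mul (contE j i).sqrt
  have contg : Continuous g := continuous_finsetSum _ fun i _ =>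
    (contφs i).add (continuous_finsetSum _ (contγs i))
  have hg0 : ∀ t, 0 ≤ g t := fun t => by positivity
  set EL : ℝ → ℝ := fun t => ∑ i, derivEnergy R l (u i t)
  have contEL : Continuous EL := continuous_finsetSum _ fun i _ => contE l i
  have hEL0 : ∀ t, 0 ≤ EL t := fun t => Finset.sum_nonneg fun i _ => derivEnergy_nonneg hR _ _
  set y : ℝ → ℝ := fun t => ∑ i, ∫ x in (0:ℝ)..R, (1 + x) * u i t x ^ 2
  have E0_le : ∀ t i, derivEnergy R 0 (u i t) ≤ ∫ x in (0:ℝ)..R, (1 + x) * u i t x ^ 2 := by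
    intro t i
    have cu := (contDiff_section (hu i) t).continuous
    simp only [derivEnergy, iteratedDeriv_zero]
    refine intervalIntegral.integral_mono_on hR.le
      (Continuous.intervalIntegrable (by fun_prop) _ _)
      (Continuous.intervalIntegrable (by fun_prop) _ _) fun x hx => ?_
    nlinarith [mul_nonneg hx.1 (sq_nonneg (u i t x))]
  have E0_le_y : ∀ t i, derivEnergy R 0 (u i t) ≤ y t := fun t i =>
    (E0_le t i).trans (Finset.single_le_sum
      (f := fun i => ∫ x in (0:ℝ)..R, (1 + x) * u i t x ^ 2)
      (fun i _ => (derivEnergy_nonneg hR 0 (u i t)).trans (E0_le t i)) (Finset.mem_univ i))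
  have sumE0_le_y : ∀ t, ∑ i, derivEnergy R 0 (u i t) ≤ y t := fun t =>
    Finset.sum_le_sum fun i _ => E0_le t i
  have smoothW : ∀ i, ContDiff ℝ (⊤ : ℕ∞) fun p : ℝ × ℝ => (1 + p.2) * u i p.1 p.2 ^ 2 :=
    fun i => (contDiff_const.add contDiff_snd).mul ((hu i).pow 2)
  have hyd : ∀ t, HasDerivAt y (∑ i, 2 * ∫ x in (0:ℝ)..R,
      deriv (fun s => u i s x) t * ((1 + x) * u i t x)) t := by
    intro t
    refine HasDerivAt.fun_sum fun i _ => ?_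
    refine (hasDerivAt_integral_of_contDiff (smoothW i) 0 R t).congr_deriv ?_
    rw [← intervalIntegral.integral_const_mul]
    congr 1
    ext x
    have h1 := (hasDerivAt_fst (hu i) t x).differentiableAt.hasDerivAt
    refine ((h1.pow 2).const_mul (1 + x)).deriv.trans ?_
    simp
    ring
  have conth : Continuous fun t => ∑ i, 2 * ∫ x in (0:ℝ)..R,
      deriv (fun s => u i s x) t * ((1 + x) * u i t x) :=
    continuous_finsetSum _ fun i _ => continuous_const.mul
      (intervalIntegral.continuous_parametric_intervalIntegral_of_continuous'
        ((contDiff_deriv_fst (hu i)).continuous.mul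
          ((continuous_const.add continuous_snd).mul (hu i).continuous)) 0 R)
  have hy0 : y 0 = 0 := by
    refine Finset.sum_eq_zero fun i _ => ?_
    rw [intervalIntegral.integral_congr (g := fun _ => (0:ℝ)) fun x hx => ?_]
    · simp
    · rw [uIcc_of_le hR.le] at hx
      simp [hinit i x hx]
  have hyn : ∀ t ∈ Icc 0 T, 0 ≤ y t := fun t _ =>
    (Finset.sum_nonneg fun i _ => derivEnergy_nonneg hR 0 (u i t)).trans (sumE0_le_y t)
  obtain ⟨bound_y, bound_EL⟩ := gronwall_dissipation hT hc.le hC hyd conth contEL contg hEL0 hg0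
    hy0 hyn fun t ht => by
      refine (energy (fun j i m => a j i m t) (fun i => f i t) (fun j i => G j i t)
        (fun i => u i t) (fun i x => deriv (fun s => u i s x) t)
        (fun j hj i m => contDiff_section (ha j hj i m) t)
        (fun j hj i m x hx => hK j hj i m t ht x hx)
        (fun i => (contDiff_section (hf i) t).continuous)
        (fun j hj i => contDiff_section (hG j hj i) t) (hbd t ht)
        (fun i x hx => heq i t ht x hx)).trans ?_
      refine add_le_add (add_le_add le_rfl (mul_le_mul_of_nonneg_left (sumE0_le_y t) hC))
        (mul_le_mul_of_nonneg_left (Finset.sum_le_sum fun i _ => ?_) hC)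
      refine add_le_add (mul_le_mul_of_nonneg_right
        (comp_le (fun i => f i t) (fun i => (contDiff_section (hf i) t).continuous) i)
        (Real.sqrt_nonneg _)) (Finset.sum_le_sum fun j hj => mul_le_mul_of_nonneg_right
        (comp_le (fun i => G j i t) (fun i => ?_) i) (Real.sqrt_nonneg _))
      exact (contDiff_section (hG j (by simpa [Nat.lt_succ_iff] using hj) i) t).continuous
  set Γ : ℝ := Real.exp (C * T) * (C * ∫ s in (0:ℝ)..T, g s) with hΓ
  have hΓ0 : 0 ≤ Γ := mul_nonneg (Real.exp_pos _).le
    (mul_nonneg hC (intervalIntegral.integral_nonneg hT.le fun t _ => hg0 t))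
  set X : ℝ := √((1 + 1 / c) * Γ)
  have hX0 : 0 ≤ X := Real.sqrt_nonneg _
  have hX2 : X ^ 2 = (1 + 1 / c) * Γ := Real.sq_sqrt (by positivity)
  have hc1 : 0 ≤ 1 / c * Γ := by positivity
  have bound0 : ∀ t ∈ Icc 0 T, ∀ i, derivEnergy R 0 (u i t) ≤ X ^ 2 := fun t ht i => by
    have := (E0_le_y t i).trans (bound_y t ht)
    linarith
  have boundl : ∀ i, ∫ t in (0:ℝ)..T, derivEnergy R l (u i t) ≤ X ^ 2 := fun i => by
    have h1 : ∫ t in (0:ℝ)..T, derivEnergy R l (u i t) ≤ ∫ t in (0:ℝ)..T, EL t :=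
      intervalIntegral.integral_mono_on hT.le ((contE l i).intervalIntegrable _ _)
        (contEL.intervalIntegrable _ _) fun t _ =>
          Finset.single_le_sum (f := fun i => derivEnergy R l (u i t))
            (fun i _ => derivEnergy_nonneg hR _ _) (Finset.mem_univ i)
    have h2 : ∫ t in (0:ℝ)..T, EL t ≤ 1 / c * Γ := by
      rw [one_div, ← div_eq_inv_mul, le_div_iff₀ hc]
      linarith
    linarith
  have bound_g : ∫ t in (0:ℝ)..T, g t ≤ n * (N * X) := by
    have cgi : ∀ i, Continuous fun t => φ t * √(derivEnergy R 0 (u i t)) +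
        ∑ j ∈ Finset.range (l + 1), γ j t * √(derivEnergy R j (u i t)) := fun i =>
      (contφs i).add (continuous_finsetSum _ (contγs i))
    simp only [hg]
    rw [intervalIntegral.integral_finsetSum fun i _ => (cgi i).intervalIntegrable _ _]
    refine (Finset.sum_le_card_nsmul _ _ (N * X) fun i _ => ?_).trans_eq (by simp)
    rw [intervalIntegral.integral_add ((contφs i).intervalIntegrable _ _)
        ((continuous_finsetSum _ (contγs i)).intervalIntegrable _ _),
      intervalIntegral.integral_finsetSum fun j hj => (contγs i j hj).intervalIntegrable _ _,
      hN, add_mul, Finset.sum_mul]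
    refine add_le_add ?_ (Finset.sum_le_sum fun j hj => ?_)
    · rw [← intervalIntegral.integral_mul_const]
      refine intervalIntegral.integral_mono_on hT.le ((contφs i).intervalIntegrable _ _)
        ((contφ.mul continuous_const).intervalIntegrable _ _) fun t ht => ?_
      exact mul_le_mul_of_nonneg_left (Real.sqrt_le_iff.2 ⟨hX0, bound0 t ht i⟩)
        (Real.sqrt_nonneg _)
    · have hj : j ≤ l := by simpa [Nat.lt_succ_iff] using hj
      rw [mixed_eq]
      refine integral_mul_le_of_pow_le hT hX0 hl hj (contγ j hj) (contE j i).sqrt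
        (r := fun t => √(derivEnergy R l (u i t))) (contE l i).sqrt
        (fun _ => Real.sqrt_nonneg _) (fun _ => Real.sqrt_nonneg _)
        (fun _ => Real.sqrt_nonneg _) (fun t ht => ?_) ?_
      · refine le_of_pow_le_pow_left₀ two_ne_zero (by positivity) ?_
        have e0 := derivEnergy_nonneg hR 0 (u i t)
        calc (√(derivEnergy R j (u i t)) ^ l) ^ 2 = (√(derivEnergy R j (u i t)) ^ 2) ^ l := by
              ring
          _ = derivEnergy R j (u i t) ^ l := by rw [Real.sq_sqrt (derivEnergy_nonneg hR _ _)]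
          _ ≤ derivEnergy R l (u i t) ^ j * derivEnergy R 0 (u i t) ^ (l - j) :=
            (hbd t ht i).derivEnergy_pow_le hR hj
          _ ≤ derivEnergy R l (u i t) ^ j * (X ^ 2) ^ (l - j) :=
            mul_le_mul_of_nonneg_left (pow_le_pow_left₀ e0 (bound0 t ht i) _)
              (pow_nonneg (derivEnergy_nonneg hR _ _) _)
          _ = (√(derivEnergy R l (u i t)) ^ 2) ^ j * (X ^ 2) ^ (l - j) := by
            rw [Real.sq_sqrt (derivEnergy_nonneg hR _ _)]
          _ = _ := by ring
      · simpa only [Real.sq_sqrt (derivEnergy_nonneg hR _ _)] using boundl i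
  have hXN : X ≤ D * N := by
    have h1 : X * X ≤ D * N * X := by
      rw [← sq, hX2, hΓ, hD]
      calc (1 + 1 / c) * (Real.exp (C * T) * (C * ∫ s in (0:ℝ)..T, g s)) ≤
            (1 + 1 / c) * (Real.exp (C * T) * (C * (n * (N * X)))) := by gcongr
        _ = _ := by ring
    rcases hX0.eq_or_lt with h0 | hpos
    · rw [← h0]
      positivity
    · exact le_of_mul_le_mul_right h1 hpos
  have hXnorm : ∀ i, XNorm l R T (u i) ≤ 2 * X := fun i => by
    rw [two_mul]
    refine add_le_add ?_ (Real.sqrt_le_iff.2 ⟨hX0, boundl i⟩)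
    refine Real.iSup_le (fun t => Real.iSup_le (fun ht => ?_) hX0) hX0
    have := bound0 t ht i
    simp only [derivEnergy, iteratedDeriv_zero] at this
    exact Real.sqrt_le_iff.2 ⟨hX0, this⟩
  calc ∑ i, XNorm l R T (u i) ≤ n * (2 * X) :=
        (Finset.sum_le_card_nsmul _ _ _ fun i _ => hXnorm i).trans_eq (by simp)
    _ ≤ n * (2 * (D * N)) := by gcongr
    _ ≤ (2 * n * D + 1) * N := by linarith
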